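/- Any instance of MLCM in which no pair of lines forms an unavoidable crossing admits a crossing-free solution, i.e., a feasible line layout in which no two lines cross. -/

import Mathlib

/-!
Core model for metro-line crossing minimization (MLCM).

An embedded graph is a symmetric loopless graph together with, for each
vertex, a list of its neighbours in clockwise order (the embedding).
A line is a simple path in the graph.  A line layout assigns to each
ordered pair `(u, v)` forming an edge the clockwise order `ord u v` in
which the lines through `{u, v}` meet the port of `u`.
-/

structure EmbeddedGraph (V : Type) where
  adj : V → V → Prop
  symm : ∀ {u v}, adj u v → adj v u
  loopless : ∀ v, ¬ adj v v
  rot : V → List V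
  rot_mem : ∀ u v, v ∈ rot u ↔ adj u v
  rot_nodup : ∀ u, (rot u).Nodup

/-- `p` is a simple path (with at least one edge) in `G`. -/
def EmbeddedGraph.IsPath {V : Type} (G : EmbeddedGraph V) (p : List V) : Prop :=
  p.Nodup ∧ 2 ≤ p.length ∧ p.Chain' G.adj

/-- An instance of MLCM: an embedded graph together with a set of lines
(indexed by `ι`), each a simple path. -/
structure MLCMInstance (V ι : Type) where
  G : EmbeddedGraph V
  line : ι → List V
  line_path : ∀ i, G.IsPath (line i)

namespace MLCMInstance

variable {V ι : Type}

/-- Line `i` passes through the edge `{u, v}`. -/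
def usesEdge (M : MLCMInstance V ι) (i : ι) (u v : V) : Prop :=
  [u, v] <:+: M.line i ∨ [v, u] <:+: M.line i

/-- `u` is a terminal (an endpoint) of line `i`. -/
def Terminal (M : MLCMInstance V ι) (i : ι) (u : V) : Prop :=
  (M.line i).head? = some u ∨ (M.line i).getLast? = some u

/-- A line layout: for each ordered pair `(u, v)`, the clockwise order
(at the port of `u`) of the lines through the edge `{u, v}`. -/
structure Layout (M : MLCMInstance V ι) where
  ord : V → V → List ι
  nodup : ∀ u v, (ord u v).Nodup
  mem_iff : ∀ u v i, i ∈ ord u v ↔ M.usesEdge i u v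

variable {M : MLCMInstance V ι}

/-- Lines `i` and `j` have an edge crossing on the edge `{u, v}`:
they appear in the same relative order in both port orders. -/
def EdgeCross (lay : M.Layout) (i j : ι) (u v : V) : Prop :=
  i ≠ j ∧ List.Sublist [i, j] (lay.ord u v) ∧ List.Sublist [i, j] (lay.ord v u)

/-- The cyclic concatenation of the port orders at `u`, following the
clockwise order of the edges incident to `u`. -/
def cyclicAt (lay : M.Layout) (u : V) : List ι :=
  (M.G.rot u).flatMap fun w => lay.ord u w

/-- Lines `i` and `j` have a vertex crossing at `u`: they alternate
`… i … j … i … j …` in the cyclic concatenation of the port orders. -/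
def VertexCross (lay : M.Layout) (i j : ι) (u : V) : Prop :=
  i ≠ j ∧ ∃ n, List.Sublist [i, j, i, j] ((cyclicAt lay u).rotate n)

/-- Lines `i` and `j` cross in the layout. -/
def Crosses (lay : M.Layout) (i j : ι) : Prop :=
  (∃ u v, EdgeCross lay i j u v ∨ EdgeCross lay j i u v) ∨
  (∃ u, VertexCross lay i j u ∨ VertexCross lay j i u)

/-- The pair of lines `i, j` has an unavoidable crossing: the lines
cross in every line layout. -/
def Unavoidable (M : MLCMInstance V ι) (i j : ι) : Prop :=
  ∀ lay : M.Layout, Crosses lay i j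

/-- A vertex crossing of `i, j` at `u` is unavoidable: it occurs in
every line layout. -/
def UnavoidableVC (M : MLCMInstance V ι) (i j : ι) (u : V) : Prop :=
  ∀ lay : M.Layout, VertexCross lay i j u ∨ VertexCross lay j i u

/-- A layout is feasible when it contains no avoidable vertex crossings. -/
def Feasible (lay : M.Layout) : Prop :=
  ∀ i j u, VertexCross lay i j u → M.UnavoidableVC i j u

/-- A layout is crossing-free when no two lines cross in it. -/
def CrossingFree (lay : M.Layout) : Prop :=
  ∀ i j, i ≠ j → ¬ Crosses lay i j

/-- The periphery condition: at every port the lines terminating at that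
vertex occupy the outermost positions of the port order. -/
def Periphery (lay : M.Layout) : Prop :=
  ∀ u v, ∃ s₁ s₂ s₃ : List ι, lay.ord u v = s₁ ++ s₂ ++ s₃ ∧
    (∀ i ∈ s₁, M.Terminal i u) ∧ (∀ i ∈ s₂, ¬ M.Terminal i u) ∧
    (∀ i ∈ s₃, M.Terminal i u)

/-- `P` occurs as a (contiguous) subpath of line `i` (in either direction). -/
def InfixOf (M : MLCMInstance V ι) (i : ι) (P : List V) : Prop :=
  P <:+: M.line i ∨ P.reverse <:+: M.line i

/-- `P` is a common subpath (with at least one edge) of lines `i` and `j`. -/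
def CommonSubpath (M : MLCMInstance V ι) (i j : ι) (P : List V) : Prop :=
  2 ≤ P.length ∧ M.InfixOf i P ∧ M.InfixOf j P

/-- `P` is the (maximal) common subpath of lines `i` and `j`. -/
def MaxCommonSubpath (M : MLCMInstance V ι) (i j : ι) (P : List V) : Prop :=
  M.CommonSubpath i j P ∧ ∀ Q, M.CommonSubpath i j Q → Q.length ≤ P.length

/-- No line is a subpath of another line. -/
def ProperLines (M : MLCMInstance V ι) : Prop :=
  ∀ i j, i ≠ j → ¬ M.InfixOf j (M.line i)

/-- Relative to the edge directed from `u` to `v`: line `i` is above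
line `j` in every crossing-free solution. -/
def MustAbove (M : MLCMInstance V ι) (i j : ι) (u v : V) : Prop :=
  ∀ lay : M.Layout, Feasible lay → CrossingFree lay → List.Sublist [i, j] (lay.ord u v)

/-- `i, j` is an overlapping pair with common subpath `P` from `u` to `v`:
`i` has its terminal at `u`, and `j` has its terminal at `v`. -/
def OverlappingPair (M : MLCMInstance V ι) (i j : ι) (P : List V) (u v : V) : Prop :=
  i ≠ j ∧ M.MaxCommonSubpath i j P ∧ P.head? = some u ∧ P.getLast? = some v ∧
    M.Terminal i u ∧ M.Terminal j v ∧ ¬ M.Terminal i v ∧ ¬ M.Terminal j u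

/-- `l` is a separator of the overlapping pair `i, j` with common subpath `P`:
on `P`, in every crossing-free solution, `l` lies between `i` and `j`. -/
def Separator (M : MLCMInstance V ι) (i j : ι) (P : List V) (l : ι) : Prop :=
  l ≠ i ∧ l ≠ j ∧ ∃ u v, [u, v] <:+: P ∧
    ((M.MustAbove i l u v ∧ M.MustAbove l j u v) ∨
     (M.MustAbove j l u v ∧ M.MustAbove l i u v))

end MLCMInstance

namespace List

variable {α β : Type*}

theorem sublist_of_subset_of_pairwise {r : α → α → Prop} (hr : ∀ a b, r a b → ¬ r b a) :
    ∀ {l l' : List α}, l.Pairwise r → l'.Pairwise r → l' ⊆ l → l'.Sublist l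
  | [], l', _, _, h => by simp_all
  | _ :: _, [], _, _, _ => nil_sublist _
  | b :: l, c :: l', hl, hl', h => by
    rw [pairwise_cons] at hl
    have hl'' := pairwise_cons.1 hl'
    by_cases hbc : c = b
    · subst hbc
      refine (sublist_of_subset_of_pairwise hr hl.2 hl''.2 fun x hx => ?_).cons_cons c
      rcases mem_cons.1 (h (mem_cons_of_mem _ hx)) with rfl | hx'
      · exact absurd (hl''.1 x hx) (hr _ _ (hl''.1 x hx))
      · exact hx'
    · have hc : c ∈ l := (mem_cons.1 (h mem_cons_self)).resolve_left hbc
      refine (sublist_of_subset_of_pairwise hr hl.2 hl' fun x hx => ?_).cons b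
      rcases mem_cons.1 (h hx) with rfl | hx'
      · rcases mem_cons.1 hx with rfl | hx
        · exact absurd rfl hbc
        · exact absurd (hl''.1 x hx) (hr _ _ (hl.1 c hc))
      · exact hx'

theorem Nodup.pair_sublist_iff [DecidableEq α] {l : List α} (hl : l.Nodup) {a b : α} :
    [a, b].Sublist l ↔ a ∈ l ∧ b ∈ l ∧ l.idxOf a < l.idxOf b := by
  induction l with
  | nil => simp
  | cons c l ih =>
    rw [nodup_cons] at hl
    have := ih hl.2
    by_cases hac : c = a
    · subst hac
      by_cases hbc : c = b
      · subst hbc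
        simp [hl.1]
      · simp [idxOf_cons_ne _ hbc, Ne.symm hbc]
    · have : [a, b].Sublist (c :: l) ↔ [a, b].Sublist l := by
        simp [sublist_cons_iff, Ne.symm hac, eq_comm]
      rw [this, ih hl.2]
      by_cases hbc : c = b
      · subst hbc
        simp [hl.1]
      · simp [idxOf_cons_ne _ hac, idxOf_cons_ne _ hbc, Ne.symm hbc, Ne.symm hac]

theorem alternate_rotate_iff {i j : α} (l : List α) :
    ((∃ n, [i, j, i, j].Sublist (l.rotate n)) ∨ ∃ n, [j, i, j, i].Sublist (l.rotate n)) ↔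
      [i, j, i, j].Sublist l ∨ [j, i, j, i].Sublist l := by
  have key : ∀ (a b : α) n, [a, b, a, b].Sublist (l.rotate n) →
      [a, b, a, b].Sublist l ∨ [b, a, b, a].Sublist l := by
    intro a b n h
    rw [rotate_eq_drop_append_take_mod] at h
    generalize n % l.length = m at h
    rw [← take_append_drop m l]
    generalize l.take m = s at *
    generalize l.drop m = t at *
    obtain ⟨x, y, hxy, hx, hy⟩ := sublist_append_iff.1 h
    rcases x with _ | ⟨x1, _ | ⟨x2, _ | ⟨x3, _ | ⟨x4, x⟩⟩⟩⟩ <;>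
      simp only [nil_append, cons_append, cons.injEq] at hxy
    · subst hxy
      exact .inl (hy.trans (sublist_append_left _ _))
    · obtain ⟨rfl, rfl⟩ := hxy
      exact .inr (hy.append hx)
    · obtain ⟨rfl, rfl, rfl⟩ := hxy
      exact .inl (hy.append hx)
    · obtain ⟨rfl, rfl, rfl, rfl⟩ := hxy
      exact .inr (hy.append hx)
    · obtain ⟨rfl, rfl, rfl, rfl, hxy⟩ := hxy
      obtain ⟨rfl, rfl⟩ := append_eq_nil_iff.1 hxy.symm
      exact .inl (hx.trans (sublist_append_right _ _))
  constructor
  · rintro (⟨n, h⟩ | ⟨n, h⟩)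
    · exact key _ _ _ h
    · exact (key _ _ _ h).symm
  · rintro (h | h)
    · exact .inl ⟨0, by simpa using h⟩
    · exact .inr ⟨0, by simpa using h⟩

/-- The lexicographic comparison of the positions of `p` and `q` in `l.flatMap f`, where a position
is given by an element `p.1` of `l` and an element `p.2` of `f p.1`. -/
def FlatBefore [DecidableEq α] (l : List α) (f : α → List β) (p q : α × β) : Prop :=
  l.idxOf p.1 < l.idxOf q.1 ∨ p.1 = q.1 ∧ [p.2, q.2].Sublist (f p.1)

theorem alternate_flatMap_iff [DecidableEq α] [DecidableEq β] {l : List α} {f : α → List β}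
    (hl : l.Nodup) (hf : ∀ a, (f a).Nodup) {i j : β} :
    [i, j, i, j].Sublist (l.flatMap f) ↔ ∃ a b c d, (a ∈ l ∧ b ∈ l ∧ c ∈ l ∧ d ∈ l) ∧
      (i ∈ f a ∧ j ∈ f b ∧ i ∈ f c ∧ j ∈ f d) ∧ FlatBefore l f (a, i) (b, j) ∧
      FlatBefore l f (b, j) (c, i) ∧ FlatBefore l f (c, i) (d, j) := by
  set D : List (α × β) := l.flatMap fun a => (f a).map (Prod.mk a) with hD
  have hmap : l.flatMap f = D.map Prod.snd := by
    simp [hD, map_flatMap, Function.comp_def]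
  have hmem : ∀ a b, (a, b) ∈ D ↔ a ∈ l ∧ b ∈ f a := by
    simp [hD]
  have hasymm : ∀ p q, FlatBefore l f p q → ¬ FlatBefore l f q p := by
    rintro ⟨a, b⟩ ⟨a', b'⟩ h h'
    simp only [FlatBefore, (hf _).pair_sublist_iff] at h h'
    grind
  have htrans : ∀ p q r, FlatBefore l f p q → FlatBefore l f q r → FlatBefore l f p r := by
    rintro ⟨a, b⟩ ⟨a', b'⟩ ⟨a'', b''⟩ h h'
    simp only [FlatBefore, (hf _).pair_sublist_iff] at h h' ⊢
    grind
  have hpair : D.Pairwise (FlatBefore l f) := by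
    rw [hD, pairwise_flatMap]
    constructor
    · intro a _
      rw [pairwise_map, pairwise_iff_forall_sublist]
      exact fun h => .inr ⟨rfl, h⟩
    · rw [pairwise_iff_forall_sublist]
      intro a b hab p hp q hq
      simp only [mem_map] at hp hq
      obtain ⟨_, _, rfl⟩ := hp
      obtain ⟨_, _, rfl⟩ := hq
      exact .inl (hl.pair_sublist_iff.1 hab).2.2
  rw [hmap, sublist_map_iff]
  constructor
  · rintro ⟨m, hm, hmi⟩
    rcases m with _ | ⟨⟨a, p⟩, _ | ⟨⟨b, q⟩, _ | ⟨⟨c, r⟩, _ | ⟨⟨d, s⟩, _ | _⟩⟩⟩⟩ <;>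
      simp at hmi
    obtain ⟨rfl, rfl, rfl, rfl⟩ := hmi
    have hsub := hm.subset
    have hp := hpair.sublist hm
    simp only [cons_subset, hmem] at hsub
    simp only [pairwise_cons, mem_cons] at hp
    exact ⟨a, b, c, d, by tauto, by tauto, hp.1 _ (by simp), hp.2.1 _ (by simp),
      hp.2.2.1 _ (by simp)⟩
  · rintro ⟨a, b, c, d, h1, h2, hab, hbc, hcd⟩
    refine ⟨[(a, i), (b, j), (c, i), (d, j)], ?_, by simp⟩
    refine sublist_of_subset_of_pairwise hasymm hpair ?_ ?_
    · have hac := htrans _ _ _ hab hbc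
      have hbd := htrans _ _ _ hbc hcd
      have had := htrans _ _ _ hac hcd
      simp [*]
    · simp only [cons_subset, hmem]
      simp [h1, h2]

theorem Nodup.append_cons_inj {p q r s : List α} {a : α} (h : (p ++ a :: r).Nodup)
    (he : p ++ a :: r = q ++ a :: s) : p = q ∧ r = s := by
  have h' := nodup_middle.1 h
  have ha : a ∉ p ++ r := (nodup_cons.1 h').1
  rw [mem_append, not_or] at ha
  have := (append_cons_inj_of_notMem ha.1 ha.2).1 he
  exact ⟨this.1, this.2.2⟩

theorem Nodup.pair_infix_right_unique {l : List α} {u v w : α} (hl : l.Nodup)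
    (hu : [u, v] <:+: l) (hw : [w, v] <:+: l) : u = w := by
  obtain ⟨p, r, rfl⟩ := hu
  obtain ⟨q, s, h⟩ := hw
  have hl' : ((p ++ [u]) ++ v :: r).Nodup := by simpa using hl
  have := (hl'.append_cons_inj (q := q ++ [w]) (s := s) (by simpa using h.symm)).1
  simpa using (append_inj' this rfl).2

theorem Nodup.not_pair_infix_swap {l : List α} {u v : α} (hl : l.Nodup) (h : [u, v] <:+: l) :
    ¬ [v, u] <:+: l := by
  rintro ⟨q, s, h'⟩
  obtain ⟨p, r, rfl⟩ := h
  have hnd : (p ++ u :: v :: r).Nodup := by simpa using hl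
  have := (hnd.append_cons_inj (q := q ++ [v]) (s := s) (by simpa using h'.symm)).1
  subst this
  simp [nodup_append] at hnd

/-- Following `l` in one of its two directions, `u` is succeeded by `v` and then by `s`. -/
def TailAfter (l : List α) (u v : α) (s : List α) : Prop :=
  (u :: v :: s) <:+ l ∨ (u :: v :: s) <:+ l.reverse

variable {l l' s t : List α} {u v w : α}

theorem pair_infix_reverse : [u, v] <:+: l.reverse ↔ [v, u] <:+: l := by
  rw [← reverse_infix]
  simp

theorem tailAfter_reverse : TailAfter l.reverse u v s ↔ TailAfter l u v s := by
  simp [TailAfter, or_comm]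

theorem exists_tailAfter_iff :
    (∃ s, TailAfter l u v s) ↔ [u, v] <:+: l ∨ [v, u] <:+: l := by
  have key : ∀ l : List α, (∃ s, (u :: v :: s) <:+ l) ↔ [u, v] <:+: l := by
    intro l
    constructor
    · rintro ⟨s, p, rfl⟩
      exact ⟨p, s, by simp⟩
    · rintro ⟨p, s, rfl⟩
      exact ⟨s, p, by simp⟩
  simp only [TailAfter, exists_or, key, pair_infix_reverse]

theorem TailAfter.tail (h : TailAfter l u v (w :: s)) : TailAfter l v w s :=
  h.imp (suffix_cons _ _).trans (suffix_cons _ _).trans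

theorem TailAfter.nodup (hl : l.Nodup) (h : TailAfter l u v s) : (u :: v :: s).Nodup := by
  rcases h with h | h
  · exact hl.sublist h.sublist
  · exact (nodup_reverse.2 hl).sublist h.sublist

theorem TailAfter.unique (hl : l.Nodup) (hs : TailAfter l u v s) (ht : TailAfter l u v t) :
    s = t := by
  have same : ∀ l : List α, l.Nodup → (u :: v :: s) <:+ l → (u :: v :: t) <:+ l → s = t := by
    rintro _ hl ⟨p, rfl⟩ ⟨q, hq⟩
    have := hl.append_cons_inj hq.symm
    simpa using this.2
  have opposite : ∀ (l s t : List α), l.Nodup → (u :: v :: s) <:+ l →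
      (u :: v :: t) <:+ l.reverse → False := by
    rintro _ s t hl ⟨p, rfl⟩ ⟨q, hq⟩
    have hq' := congrArg reverse hq
    have := (hl.append_cons_inj (q := t.reverse ++ [v]) (s := q.reverse)
      (by rw [← reverse_reverse (p ++ _), ← hq]; simp)).1
    subst this
    simp [nodup_append] at hl
  rcases hs with hs | hs <;> rcases ht with ht | ht
  · exact same l hl hs ht
  · exact (opposite l s t hl hs ht).elim
  · exact (opposite l t s hl ht hs).elim
  · exact same _ (nodup_reverse.2 hl) hs ht

theorem TailAfter.exists_eq_cons (hl : l.Nodup) (hs : TailAfter l u v s)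
    (hw : [v, w] <:+: l ∨ [w, v] <:+: l) (hne : w ≠ u) : ∃ t, s = w :: t := by
  have key : ∀ l : List α, l.Nodup → (u :: v :: s) <:+ l → ([v, w] <:+: l ∨ [w, v] <:+: l) →
      ∃ t, s = w :: t := by
    rintro _ hl ⟨p, rfl⟩ (⟨x, y, h⟩ | ⟨x, y, h⟩)
    · have hl' : (p ++ [u] ++ v :: s).Nodup := by simpa using hl
      have := (hl'.append_cons_inj (q := x) (s := w :: y) (by simpa using h.symm)).2
      exact ⟨y, this⟩
    · have hl' : (p ++ [u] ++ v :: s).Nodup := by simpa using hl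
      have := (hl'.append_cons_inj (q := x ++ [w]) (s := y) (by simpa using h.symm)).1
      have := (append_inj' this rfl).2
      simp at this
      exact absurd this.symm hne
  rcases hs with hs | hs
  · exact key l hl hs hw
  · exact key _ (nodup_reverse.2 hl) hs
      (by rw [pair_infix_reverse, pair_infix_reverse]; exact hw.symm)

theorem TailAfter.append_eq (hl : l.Nodup) (hs : TailAfter l u v s) (ht : TailAfter l v u t) :
    t.reverse ++ u :: v :: s = l ∨ t.reverse ++ u :: v :: s = l.reverse := by
  have key : ∀ l : List α, l.Nodup → (u :: v :: s) <:+ l → TailAfter l v u t →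
      t.reverse ++ u :: v :: s = l := by
    rintro l hl ⟨p, rfl⟩ ht
    have : TailAfter (p ++ u :: v :: s) v u p.reverse := .inr ⟨s.reverse, by simp⟩
    rw [ht.unique hl this, reverse_reverse]
  rcases hs with hs | hs
  · exact .inl (key l hl hs ht)
  · exact .inr (key _ (nodup_reverse.2 hl) hs (tailAfter_reverse.2 ht))

theorem TailAfter.isChain {r : α → α → Prop} (hr : ∀ {a b}, r a b → r b a) (hl : l.IsChain r)
    (hs : TailAfter l u v s) : (u :: v :: s).IsChain r := by
  rcases hs with hs | hs
  · exact hl.infix hs.isInfix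
  · refine IsChain.infix ?_ hs.isInfix
    rw [isChain_reverse]
    exact hl.imp fun _ _ h => hr h

/-- If the parts of `l` on both sides of `u v` are continued by those of `l'`, then `l` or its
reverse is an infix of `l'`. -/
theorem infix_of_tailAfter_prefix {s' t' : List α} (hl : l.Nodup) (hl' : l'.Nodup)
    (hs : TailAfter l u v s) (ht : TailAfter l v u t) (hs' : TailAfter l' u v s')
    (ht' : TailAfter l' v u t') (h1 : s <+: s') (h2 : t <+: t') :
    l <:+: l' ∨ l.reverse <:+: l' := by
  obtain ⟨x, rfl⟩ := h1
  obtain ⟨y, rfl⟩ := h2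
  have hinf : t.reverse ++ u :: v :: s <:+: (t ++ y).reverse ++ u :: v :: (s ++ x) :=
    ⟨y.reverse, x, by simp⟩
  rcases hs.append_eq hl ht with h | h <;> rcases hs'.append_eq hl' ht' with h' | h' <;>
    rw [h, h'] at hinf
  · exact .inl hinf
  · exact .inr (by rwa [← reverse_infix, reverse_reverse])
  · exact .inr hinf
  · exact .inl (reverse_infix.1 hinf)

end List

namespace EmbeddedGraph

variable {V : Type} (G : EmbeddedGraph V)

open Classical in
/-- The position of `a` in the list of the neighbours of `u`. -/
noncomputable def pos (u a : V) : ℕ := (G.rot u).idxOf a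

/-- Around `v`, one meets `u`, `a`, `b` in this cyclic order. -/
def Clockwise (v u a b : V) : Prop :=
  (G.pos v u < G.pos v a ∧ G.pos v a < G.pos v b) ∨
  (G.pos v a < G.pos v b ∧ G.pos v b < G.pos v u) ∨
  (G.pos v b < G.pos v u ∧ G.pos v u < G.pos v a)

/-- The walks `u, v, s` and `u, v, t` separate at some vertex, and the former one takes there
the exit that comes first in clockwise order. -/
def TurnLt : V → V → List V → List V → Prop
  | u, v, a :: s, b :: t => G.Clockwise v u a b ∨ a = b ∧ TurnLt v a s t
  | _, _, _, _ => False

variable {G}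

open Classical in
theorem pos_inj {u a b : V} (ha : G.adj u a) (h : G.pos u a = G.pos u b) : a = b :=
  (List.idxOf_inj ((G.rot_mem u a).2 ha)).1 h

theorem Clockwise.ne {v u a b : V} (h : G.Clockwise v u a b) : a ≠ b := by
  rintro rfl
  simp only [Clockwise] at h
  omega

theorem turnLt_cons {u v a b : V} {s t : List V} :
    G.TurnLt u v (a :: s) (b :: t) ↔ G.Clockwise v u a b ∨ a = b ∧ G.TurnLt v a s t := by
  rw [TurnLt]

theorem turnLt_cons_self {u v a : V} {s t : List V} :
    G.TurnLt u v (a :: s) (a :: t) ↔ G.TurnLt v a s t := by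
  rw [turnLt_cons]
  simpa using fun h : G.Clockwise v u a a => absurd rfl h.ne

theorem not_turnLt_nil_left {u v : V} {t : List V} : ¬ G.TurnLt u v [] t := by
  simp [TurnLt]

theorem not_turnLt_nil_right {u v : V} {s : List V} : ¬ G.TurnLt u v s [] := by
  simp [TurnLt]

theorem turnLt_irrefl (s : List V) : ∀ u v, ¬ G.TurnLt u v s s := by
  induction s with
  | nil => exact fun _ _ => not_turnLt_nil_left
  | cons a s ih => exact fun u v => turnLt_cons_self.not.2 (ih v a)

theorem TurnLt.trans {s : List V} : ∀ {t r : List V} {u v : V},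
    G.TurnLt u v s t → G.TurnLt u v t r → G.TurnLt u v s r := by
  induction s with
  | nil => exact fun h => absurd h not_turnLt_nil_left
  | cons a s ih =>
    rintro (_ | ⟨b, t⟩) (_ | ⟨c, r⟩) u v h h'
    any_goals first
      | exact absurd h not_turnLt_nil_right
      | exact absurd h' not_turnLt_nil_right
    rw [turnLt_cons] at *
    rcases h with h | ⟨rfl, h⟩ <;> rcases h' with h' | ⟨rfl, h'⟩
    · left
      simp only [Clockwise] at *
      omega
    · exact .inl h
    · exact .inl h'
    · exact .inr ⟨rfl, ih h h'⟩

theorem TurnLt.of_prefix_left {s : List V} : ∀ {t r : List V} {u v : V},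
    G.TurnLt u v s t → s <+: r → G.TurnLt u v r t := by
  induction s with
  | nil => exact fun h => absurd h not_turnLt_nil_left
  | cons a s ih =>
    rintro (_ | ⟨b, t⟩) r u v h ⟨x, rfl⟩
    · exact absurd h not_turnLt_nil_right
    · rw [List.cons_append, turnLt_cons] at *
      exact h.imp id fun h => ⟨h.1, ih h.2 ⟨x, rfl⟩⟩

theorem TurnLt.of_prefix_right {s : List V} : ∀ {t r : List V} {u v : V},
    G.TurnLt u v s t → t <+: r → G.TurnLt u v s r := by
  induction s with
  | nil => exact fun h => absurd h not_turnLt_nil_left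
  | cons a s ih =>
    rintro (_ | ⟨b, t⟩) r u v h ⟨x, rfl⟩
    · exact absurd h not_turnLt_nil_right
    · rw [List.cons_append, turnLt_cons] at *
      exact h.imp id fun h => ⟨h.1, ih h.2 ⟨x, rfl⟩⟩

theorem clockwise_total {v u a b : V} (hu : G.adj v u) (ha : G.adj v a)
    (hua : u ≠ a) (hub : u ≠ b) (hab : a ≠ b) : G.Clockwise v u a b ∨ G.Clockwise v u b a := by
  have := mt (pos_inj hu) hua
  have := mt (pos_inj hu) hub
  have := mt (pos_inj ha) hab
  simp only [Clockwise]
  omega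

theorem turnLt_total {s : List V} : ∀ {t : List V} {u v : V}, (u :: v :: s).Nodup →
    (u :: v :: t).Nodup → (u :: v :: s).IsChain G.adj → (u :: v :: t).IsChain G.adj →
    G.TurnLt u v s t ∨ G.TurnLt u v t s ∨ s <+: t ∨ t <+: s := by
  induction s with
  | nil => simp
  | cons a s ih =>
    rintro (_ | ⟨b, t⟩) u v hs ht hs' ht'
    · simp
    · by_cases hab : a = b
      · subst hab
        have := ih hs.of_cons ht.of_cons hs'.tail ht'.tail
        simpa [turnLt_cons_self] using this
      · simp only [List.isChain_cons_cons] at hs' ht'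
        have := clockwise_total (G.symm hs'.1) hs'.2.1 (by grind) (by grind) hab
        simp only [turnLt_cons]
        tauto

end EmbeddedGraph

/-- A finite set that is linearly ordered by a relation can be listed in increasing order. -/
theorem Finset.exists_nodup_pairwise {α : Type*} (s : Finset α) (r : α → α → Prop)
    (trans : ∀ a ∈ s, ∀ b ∈ s, ∀ c ∈ s, r a b → r b c → r a c)
    (total : ∀ a ∈ s, ∀ b ∈ s, a ≠ b → r a b ∨ r b a) (irrefl : ∀ a ∈ s, ¬ r a a) :
    ∃ l : List α, l.Nodup ∧ (∀ a, a ∈ l ↔ a ∈ s) ∧ l.Pairwise r := by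
  classical
  let r' : s → s → Prop := fun a b => a = b ∨ r a b
  have : IsTrans s r' := ⟨by
    rintro a b c (rfl | h) (rfl | h')
    · exact .inl rfl
    · exact .inr h'
    · exact .inr h
    · exact .inr (trans _ a.2 _ b.2 _ c.2 h h')⟩
  have : Std.Antisymm r' := ⟨by
    rintro a b (rfl | h) (h' | h')
    · rfl
    · rfl
    · exact h'.symm
    · exact absurd (trans _ a.2 _ b.2 _ a.2 h h') (irrefl _ a.2)⟩
  have : Std.Total r' := ⟨by
    intro a b
    by_cases hab : a = b
    · exact .inl (.inl hab)
    · exact (total _ a.2 _ b.2 (Subtype.coe_injective.ne hab)).imp .inr .inr⟩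
  refine ⟨((Finset.univ : Finset s).sort r').map Subtype.val,
    (Finset.sort_nodup _ _).map Subtype.coe_injective, by simp, ?_⟩
  rw [List.pairwise_map]
  refine ((Finset.pairwise_sort _ r').and (Finset.sort_nodup _ r')).imp ?_
  rintro a b ⟨rfl | h, hne⟩
  · exact absurd rfl hne
  · exact h

namespace MLCMInstance

variable {V ι : Type} {M : MLCMInstance V ι}

theorem usesEdge_comm {i : ι} {u v : V} : M.usesEdge i u v ↔ M.usesEdge i v u :=
  or_comm

theorem usesEdge.tailAfter {i : ι} {u v : V} (h : M.usesEdge i u v) :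
    ∃ s, (M.line i).TailAfter u v s :=
  List.exists_tailAfter_iff.2 h

theorem adj_of_tailAfter {i : ι} {u v : V} {s : List V} (h : (M.line i).TailAfter u v s) :
    (u :: v :: s).IsChain M.G.adj :=
  h.isChain M.G.symm (M.line_path i).2.2

theorem usesEdge.adj {i : ι} {u v : V} (h : M.usesEdge i u v) : M.G.adj u v := by
  obtain ⟨s, hs⟩ := h.tailAfter
  exact (List.isChain_cons_cons.1 (adj_of_tailAfter hs)).1

theorem usesEdge.mem_rot {i : ι} {u v : V} (h : M.usesEdge i u v) : v ∈ M.G.rot u :=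
  (M.G.rot_mem u v).2 h.adj

open Classical in
/-- What remains of the line `i` after it has traversed the edge `u v` from `u` to `v`. -/
noncomputable def rest (M : MLCMInstance V ι) (i : ι) (u v : V) : List V :=
  if h : ∃ s, (M.line i).TailAfter u v s then h.choose else []

theorem rest_spec {i : ι} {u v : V} (h : M.usesEdge i u v) :
    (M.line i).TailAfter u v (M.rest i u v) := by
  have := h.tailAfter
  rw [rest, dif_pos this]
  exact this.choose_spec

theorem rest_eq_cons {i : ι} {u v w : V} (huv : M.usesEdge i u v) (hvw : M.usesEdge i v w)
    (hne : w ≠ u) : M.rest i u v = w :: M.rest i v w := by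
  obtain ⟨t, ht⟩ := (rest_spec huv).exists_eq_cons (M.line_path i).1 hvw hne
  rw [ht, List.cons.injEq]
  refine ⟨rfl, ?_⟩
  have := rest_spec huv
  rw [ht] at this
  exact this.tail.unique (M.line_path i).1 (rest_spec hvw)

theorem usesEdge_of_rest_eq_cons {i : ι} {u v w : V} {s : List V} (huv : M.usesEdge i u v)
    (h : M.rest i u v = w :: s) : M.usesEdge i v w ∧ w ≠ u ∧ M.rest i v w = s := by
  have hs := rest_spec huv
  rw [h] at hs
  have hvw : M.usesEdge i v w := List.exists_tailAfter_iff.1 ⟨s, hs.tail⟩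
  refine ⟨hvw, ?_, (rest_spec hvw).unique (M.line_path i).1 hs.tail⟩
  rintro rfl
  simpa using hs.nodup (M.line_path i).1

/-- Following the edge `u v` from `u` to `v`, the lines `i` and `j` separate eventually, and `i`
comes before `j` in the clockwise order of the exits. -/
def Ahead (M : MLCMInstance V ι) (u v : V) (i j : ι) : Prop :=
  M.G.TurnLt u v (M.rest i u v) (M.rest j u v)

theorem ahead_step {i j : ι} {u v w : V} (hi : M.usesEdge i u v) (hi' : M.usesEdge i v w)
    (hj : M.usesEdge j u v) (hj' : M.usesEdge j v w) (hne : w ≠ u) :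
    M.Ahead u v i j ↔ M.Ahead v w i j := by
  rw [Ahead, Ahead, rest_eq_cons hi hi' hne, rest_eq_cons hj hj' hne,
    EmbeddedGraph.turnLt_cons_self]

theorem ahead_of_clockwise {i j : ι} {u v a b : V} (hi : M.usesEdge i u v)
    (hj : M.usesEdge j u v) (hi' : M.usesEdge i v a) (hj' : M.usesEdge j v b) (ha : a ≠ u)
    (hb : b ≠ u) (h : M.G.Clockwise v u a b) : M.Ahead u v i j := by
  rw [Ahead, rest_eq_cons hi hi' ha, rest_eq_cons hj hj' hb, EmbeddedGraph.turnLt_cons]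
  exact .inl h

/-- Lines that separate at `v` do so in the same order as all the lines that follow them. -/
theorem ahead_or_usesEdge {i j g : ι} {u v w : V} (hi : M.usesEdge i u v) (hi' : M.usesEdge i v w)
    (hj : M.usesEdge j u v) (hj' : M.usesEdge j v w) (hg : M.usesEdge g u v) (hne : w ≠ u) :
    (M.Ahead u v i g → M.usesEdge g v w ∨ M.Ahead u v j g) ∧
    (M.Ahead u v g i → M.usesEdge g v w ∨ M.Ahead u v g j) := by
  simp only [Ahead, rest_eq_cons hi hi' hne, rest_eq_cons hj hj' hne]
  rcases hr : M.rest g u v with _ | ⟨x, s⟩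
  · simp [EmbeddedGraph.TurnLt]
  · have := (usesEdge_of_rest_eq_cons hg hr).1
    by_cases hx : x = w
    · subst hx
      simp [this]
    · simp only [EmbeddedGraph.turnLt_cons, hx, Ne.symm hx, false_and, or_false]
      exact ⟨.inr, .inr⟩

open Classical in
theorem vertexCross_or_iff {lay : M.Layout} {i j : ι} {u : V} :
    VertexCross lay i j u ∨ VertexCross lay j i u ↔ i ≠ j ∧
      ([i, j, i, j].Sublist (cyclicAt lay u) ∨ [j, i, j, i].Sublist (cyclicAt lay u)) := by
  rw [← List.alternate_rotate_iff]
  simp only [VertexCross, ne_comm (a := j), and_or_left]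

/-- The lines `i` and `j` alternate around `u`, with their ports listed in the order of `u`. -/
def Alternate (lay : M.Layout) (i j : ι) (u : V) : Prop :=
  ∃ a b c d, M.usesEdge i u a ∧ M.usesEdge j u b ∧ M.usesEdge i u c ∧ M.usesEdge j u d ∧
    (M.G.pos u a < M.G.pos u b ∨ a = b ∧ [i, j].Sublist (lay.ord u a)) ∧
    (M.G.pos u b < M.G.pos u c ∨ b = c ∧ [j, i].Sublist (lay.ord u b)) ∧
    (M.G.pos u c < M.G.pos u d ∨ c = d ∧ [i, j].Sublist (lay.ord u c))

open Classical in
theorem alternate_iff {lay : M.Layout} {i j : ι} {u : V} :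
    Alternate lay i j u ↔ [i, j, i, j].Sublist (cyclicAt lay u) := by
  rw [cyclicAt, List.alternate_flatMap_iff (M.G.rot_nodup u) (lay.nodup u)]
  simp only [lay.mem_iff, List.FlatBefore, Alternate]
  refine exists_congr fun a => exists_congr fun b => exists_congr fun c => exists_congr fun d => ?_
  constructor
  · rintro ⟨ha, hb, hc, hd, h⟩
    exact ⟨⟨ha.mem_rot, hb.mem_rot, hc.mem_rot, hd.mem_rot⟩, ⟨ha, hb, hc, hd⟩, h⟩
  · rintro ⟨-, ⟨ha, hb, hc, hd⟩, h⟩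
    exact ⟨ha, hb, hc, hd, h⟩

theorem vertexCross_iff {lay : M.Layout} {i j : ι} {u : V} :
    VertexCross lay i j u ∨ VertexCross lay j i u ↔
      i ≠ j ∧ (Alternate lay i j u ∨ Alternate lay j i u) := by
  rw [vertexCross_or_iff, alternate_iff, alternate_iff]

theorem pair_sublist_or {lay : M.Layout} {i j : ι} {u v : V} (hij : i ≠ j)
    (hi : M.usesEdge i u v) (hj : M.usesEdge j u v) :
    [i, j].Sublist (lay.ord u v) ∨ [j, i].Sublist (lay.ord u v) := by
  classical
  rw [← lay.mem_iff] at hi hj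
  rw [(lay.nodup u v).pair_sublist_iff, (lay.nodup u v).pair_sublist_iff]
  have := mt (List.idxOf_inj hi).1 hij
  simp only [hi, hj, true_and]
  omega

theorem sublist_swap {lay : M.Layout} {i j : ι} (hc : ¬ Crosses lay i j) (hij : i ≠ j) {u v : V}
    (h : [i, j].Sublist (lay.ord u v)) : [j, i].Sublist (lay.ord v u) := by
  have hi : i ∈ lay.ord u v := h.subset (by simp)
  have hj : j ∈ lay.ord u v := h.subset (by simp)
  rw [lay.mem_iff, usesEdge_comm] at hi hj
  refine (pair_sublist_or hij hi hj).resolve_left fun h' => hc (.inl ⟨u, v, .inl ⟨hij, h, h'⟩⟩)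

theorem not_alternate {lay : M.Layout} {i j : ι} (hc : ¬ Crosses lay i j) (hij : i ≠ j) (u : V) :
    ¬ Alternate lay i j u ∧ ¬ Alternate lay j i u := by
  rw [← not_or]
  exact fun h => hc (.inr ⟨u, vertexCross_iff.2 ⟨hij, h⟩⟩)

/-- A layout in which `i` and `j` do not cross orders them as their separation demands. -/
theorem sublist_of_ahead {lay : M.Layout} {i j : ι} (hc : ¬ Crosses lay i j) (hij : i ≠ j)
    {u v : V} (hi : M.usesEdge i u v) (hj : M.usesEdge j u v) (h : M.Ahead u v i j) :
    [i, j].Sublist (lay.ord u v) := by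
  generalize hs : M.rest i u v = s
  induction s generalizing u v with
  | nil =>
    rw [Ahead, hs] at h
    exact absurd h EmbeddedGraph.not_turnLt_nil_left
  | cons a s ih =>
    rcases ht : M.rest j u v with _ | ⟨b, t⟩
    · rw [Ahead, ht] at h
      exact absurd h EmbeddedGraph.not_turnLt_nil_right
    · obtain ⟨hi', hau, hs'⟩ := usesEdge_of_rest_eq_cons hi hs
      obtain ⟨hj', hbu, ht'⟩ := usesEdge_of_rest_eq_cons hj ht
      refine (pair_sublist_or hij hi hj).resolve_right fun hji => ?_
      have hji' := sublist_swap (fun h => hc (by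
        simpa only [Crosses, or_comm] using h)) hij.symm hji
      have halt := not_alternate hc hij v
      rw [usesEdge_comm] at hi hj
      rw [Ahead, hs, ht, EmbeddedGraph.turnLt_cons] at h
      rcases h with h | ⟨rfl, h⟩
      · rcases h with h | h | h
        · exact halt.1 ⟨u, u, a, b, hi, hj, hi', hj', .inr ⟨rfl, hji'⟩, .inl h.1, .inl h.2⟩
        · exact halt.1 ⟨a, b, u, u, hi', hj', hi, hj, .inl h.1, .inl h.2, .inr ⟨rfl, hji'⟩⟩
        · exact halt.2 ⟨b, u, u, a, hj', hi, hj, hi', .inl h.1, .inr ⟨rfl, hji'⟩, .inl h.2⟩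
      · have hlay := ih hi' hj' (by rwa [Ahead, hs', ht']) hs'
        have : M.G.pos v u ≠ M.G.pos v a := fun h =>
          hau (EmbeddedGraph.pos_inj hi.adj h).symm
        rcases this.lt_or_gt with h | h
        · exact halt.1 ⟨u, u, a, a, hi, hj, hi', hj', .inr ⟨rfl, hji'⟩, .inl h, .inr ⟨rfl, hlay⟩⟩
        · exact halt.1 ⟨a, a, u, u, hi', hj', hi, hj, .inr ⟨rfl, hlay⟩, .inl h, .inr ⟨rfl, hji'⟩⟩

theorem ahead_compat {i j : ι} (h : ¬ M.Unavoidable i j) (hij : i ≠ j) {u v : V}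
    (hi : M.usesEdge i u v) (hj : M.usesEdge j u v) (h1 : M.Ahead u v i j) : ¬ M.Ahead v u i j := by
  intro h2
  obtain ⟨lay, hc⟩ := not_forall.1 h
  exact hc (.inl ⟨u, v, .inl ⟨hij, sublist_of_ahead hc hij hi hj h1,
    sublist_of_ahead hc hij (usesEdge_comm.1 hi) (usesEdge_comm.1 hj) h2⟩⟩)

theorem pos_not_alternate {i j : ι} (h : ¬ M.Unavoidable i j) (hij : i ≠ j) {u a b c d : V}
    (ha : M.usesEdge i u a) (hb : M.usesEdge j u b) (hc : M.usesEdge i u c)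
    (hd : M.usesEdge j u d) (hab : M.G.pos u a < M.G.pos u b) (hbc : M.G.pos u b < M.G.pos u c) :
    ¬ M.G.pos u c < M.G.pos u d := by
  intro hcd
  obtain ⟨lay, hl⟩ := not_forall.1 h
  exact (not_alternate hl hij u).1 ⟨a, b, c, d, ha, hb, hc, hd, .inl hab, .inl hbc, .inl hcd⟩

end MLCMInstance

/-- Two transitive relations `F` and `B` that do not contradict each other on `p`, where `F` fails
to compare only elements comparable by the preorder `PF`, and `B` only those comparable by `PB`. -/
structure TwoSidedOrder {α : Type*} (p : α → Prop) (F B PF PB : α → α → Prop) : Prop where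
  F_trans : ∀ {a b c}, F a b → F b c → F a c
  B_trans : ∀ {a b c}, B a b → B b c → B a c
  F_irrefl : ∀ a, ¬ F a a
  B_irrefl : ∀ a, ¬ B a a
  F_left : ∀ {a b c}, F a b → PF a c → F c b
  F_right : ∀ {a b c}, F a b → PF b c → F a c
  B_left : ∀ {a b c}, B a b → PB a c → B c b
  B_right : ∀ {a b c}, B a b → PB b c → B a c
  PF_trans : ∀ {a b c}, PF a b → PF b c → PF a c
  PB_trans : ∀ {a b c}, PB a b → PB b c → PB a c
  F_total : ∀ {a b}, p a → p b → F a b ∨ F b a ∨ PF a b ∨ PF b a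
  B_total : ∀ {a b}, p a → p b → B a b ∨ B b a ∨ PB a b ∨ PB b a
  compat : ∀ {a b}, p a → p b → F a b → ¬ B b a
  proper : ∀ {a b}, p a → p b → PF a b → PB a b → a = b

/-- The elements `a` and `b` are compared by `F` or `B`, directly or with a third element between
them. -/
def Separated {α : Type*} (p : α → Prop) (F B : α → α → Prop) (a b : α) : Prop :=
  F a b ∨ B a b ∨ (∃ g, p g ∧ F a g ∧ B g b) ∨ (∃ g, p g ∧ B a g ∧ F g b)

/-- The order by separation, in which `a` comes before `b` also if they are not separated, `PF a b`
and `PB b a`. -/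
def Comb {α : Type*} (p : α → Prop) (F B PF PB : α → α → Prop) (a b : α) : Prop :=
  Separated p F B a b ∨ (PF a b ∧ PB b a ∧ ¬ Separated p F B b a)

namespace TwoSidedOrder

variable {α : Type*} {p : α → Prop} {F B PF PB : α → α → Prop}

theorem sep_asymm (h : TwoSidedOrder p F B PF PB) {a b : α} (ha : p a) (hb : p b)
    (h1 : Separated p F B a b) (h2 : Separated p F B b a) : False := by
  obtain ⟨F_trans, B_trans, F_irrefl, B_irrefl, F_left, F_right, B_left, B_right, PF_trans,
    PB_trans, F_total, B_total, compat, proper⟩ := h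
  rcases h1 with h1 | h1 | ⟨g, hg, h1, h1'⟩ | ⟨g, hg, h1, h1'⟩ <;>
  rcases h2 with h2 | h2 | ⟨k, hk, h2, h2'⟩ | ⟨k, hk, h2, h2'⟩ <;> grind

theorem comb_asymm (h : TwoSidedOrder p F B PF PB) {a b : α} (ha : p a) (hb : p b) (hne : a ≠ b)
    (h1 : Comb p F B PF PB a b) (h2 : Comb p F B PF PB b a) : False := by
  rcases h1 with h1 | h1 <;> rcases h2 with h2 | h2
  · exact h.sep_asymm ha hb h1 h2
  · exact h2.2.2 h1
  · exact h1.2.2 h2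
  · exact hne (h.proper ha hb h1.1 h2.2.1)

theorem comb_total (h : TwoSidedOrder p F B PF PB) {a b : α} (ha : p a) (hb : p b) (hne : a ≠ b) :
    Comb p F B PF PB a b ∨ Comb p F B PF PB b a := by
  have := h.F_total ha hb
  have := h.B_total ha hb
  have := @h.proper a b ha hb
  have := @h.proper b a hb ha
  simp only [Comb]
  grind [Separated]

theorem not_separated {a b : α} : ¬ Separated p F B a b ↔ ¬ F a b ∧ ¬ B a b ∧
    (∀ g, p g → F a g → ¬ B g b) ∧ ∀ g, p g → B a g → ¬ F g b := by
  simp [Separated]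

theorem no_cycle (h : TwoSidedOrder p F B PF PB) {a b c : α} (ha : p a) (hb : p b) (hc : p c)
    (hca : c ≠ a) (h1 : Comb p F B PF PB a b) (h2 : Comb p F B PF PB b c)
    (h3 : Comb p F B PF PB c a) : False := by
  obtain ⟨F_trans, B_trans, F_irrefl, B_irrefl, F_left, F_right, B_left, B_right, PF_trans,
    PB_trans, F_total, B_total, compat, proper⟩ := h
  have := F_total ha hb
  have := F_total hb hc
  have := F_total hc ha
  have := B_total ha hb
  have := B_total hb hc
  have := B_total hc ha
  simp only [Comb, not_separated] at h1 h2 h3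
  rcases h1 with (h1 | h1 | ⟨g, hg, h1, h1'⟩ | ⟨g, hg, h1, h1'⟩) | ⟨h1, h1', h1''⟩ <;>
  rcases h2 with (h2 | h2 | ⟨k, hk, h2, h2'⟩ | ⟨k, hk, h2, h2'⟩) | ⟨h2, h2', h2''⟩ <;>
  rcases h3 with (h3 | h3 | ⟨l, hl, h3, h3'⟩ | ⟨l, hl, h3, h3'⟩) | ⟨h3, h3', h3''⟩ <;>
  first | (clear F_total B_total; grind) | grind

end TwoSidedOrder

namespace MLCMInstance

variable {V ι : Type} {M : MLCMInstance V ι}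

/-- The separation order, at the port of `u` towards `v`, of the lines that satisfy `P`. -/
def SeparatedAt (M : MLCMInstance V ι) (P : ι → Prop) (u v : V) : ι → ι → Prop :=
  Separated (fun g => P g ∧ M.usesEdge g u v) (M.Ahead u v) (fun a b => M.Ahead v u b a)

/-- The order, at the port of `u` towards `v`, of the lines that satisfy `P`. -/
def CombAt (M : MLCMInstance V ι) (P : ι → Prop) (u v : V) : ι → ι → Prop :=
  Comb (fun g => P g ∧ M.usesEdge g u v) (M.Ahead u v) (fun a b => M.Ahead v u b a)
    (fun a b => M.rest a u v <+: M.rest b u v) (fun a b => M.rest a v u <+: M.rest b v u)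

variable {P : ι → Prop}

theorem ahead_total {i j : ι} {u v : V} (hi : M.usesEdge i u v) (hj : M.usesEdge j u v) :
    M.Ahead u v i j ∨ M.Ahead u v j i ∨ M.rest i u v <+: M.rest j u v ∨
      M.rest j u v <+: M.rest i u v :=
  EmbeddedGraph.turnLt_total ((rest_spec hi).nodup (M.line_path i).1)
    ((rest_spec hj).nodup (M.line_path j).1) (adj_of_tailAfter (rest_spec hi))
    (adj_of_tailAfter (rest_spec hj))

theorem twoSidedOrder (hU : ∀ i j : ι, i ≠ j → ¬ M.Unavoidable i j)
    (hP : ∀ a b, P a → P b → M.InfixOf b (M.line a) → a = b) (u v : V) :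
    TwoSidedOrder (fun g => P g ∧ M.usesEdge g u v) (M.Ahead u v) (fun a b => M.Ahead v u b a)
      (fun a b => M.rest a u v <+: M.rest b u v) (fun a b => M.rest a v u <+: M.rest b v u) where
  F_trans := EmbeddedGraph.TurnLt.trans
  B_trans h h' := EmbeddedGraph.TurnLt.trans h' h
  F_irrefl _ := EmbeddedGraph.turnLt_irrefl _ _ _
  B_irrefl _ := EmbeddedGraph.turnLt_irrefl _ _ _
  F_left := EmbeddedGraph.TurnLt.of_prefix_left
  F_right := EmbeddedGraph.TurnLt.of_prefix_right
  B_left := EmbeddedGraph.TurnLt.of_prefix_right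
  B_right := EmbeddedGraph.TurnLt.of_prefix_left
  PF_trans := List.IsPrefix.trans
  PB_trans := List.IsPrefix.trans
  F_total ha hb := ahead_total ha.2 hb.2
  B_total ha hb := by
    have := ahead_total (usesEdge_comm.1 ha.2) (usesEdge_comm.1 hb.2)
    tauto
  compat {a b} ha hb h := by
    by_cases hab : a = b
    · subst hab
      exact fun _ => EmbeddedGraph.turnLt_irrefl _ _ _ h
    · exact ahead_compat (hU a b hab) hab ha.2 hb.2 h
  proper {a b} ha hb h h' := hP a b ha.1 hb.1 <|
    List.infix_of_tailAfter_prefix (M.line_path a).1 (M.line_path b).1 (rest_spec ha.2)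
      (rest_spec (usesEdge_comm.1 ha.2)) (rest_spec hb.2) (rest_spec (usesEdge_comm.1 hb.2)) h h'

theorem separatedAt_swap {a b : ι} {u v : V} :
    M.SeparatedAt P u v a b ↔ M.SeparatedAt P v u b a := by
  have : ∀ {a b u v}, M.SeparatedAt P u v a b → M.SeparatedAt P v u b a := by
    intro a b u v h
    rcases h with h | h | ⟨g, hg, h, h'⟩ | ⟨g, hg, h, h'⟩
    · exact .inr (.inl h)
    · exact .inl h
    · exact .inr (.inr (.inl ⟨g, ⟨hg.1, usesEdge_comm.1 hg.2⟩, h', h⟩))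
    · exact .inr (.inr (.inr ⟨g, ⟨hg.1, usesEdge_comm.1 hg.2⟩, h', h⟩))
  exact ⟨this, this⟩

theorem combAt_swap {a b : ι} {u v : V} (h : M.CombAt P u v a b) : M.CombAt P v u b a :=
  h.imp separatedAt_swap.1 fun ⟨h1, h2, h3⟩ => ⟨h2, h1, fun h => h3 (separatedAt_swap.1 h)⟩

theorem separatedAt_step (hU : ∀ i j : ι, i ≠ j → ¬ M.Unavoidable i j) {a b : ι} {u v w : V}
    (ha : M.usesEdge a u v) (ha' : M.usesEdge a v w) (hb : M.usesEdge b u v)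
    (hb' : M.usesEdge b v w) (hne : w ≠ u) :
    M.SeparatedAt P u v a b ↔ M.SeparatedAt P v w a b := by
  have hcompat : ∀ {i j u v}, M.usesEdge i u v → M.usesEdge j u v →
      M.Ahead u v i j → ¬ M.Ahead v u i j := by
    intro i j u v hi hj h
    by_cases hij : i = j
    · subst hij
      exact fun _ => EmbeddedGraph.turnLt_irrefl _ _ _ h
    · exact ahead_compat (hU i j hij) hij hi hj h
  have key : ∀ {a b u v w}, M.usesEdge a u v → M.usesEdge a v w → M.usesEdge b u v →
      M.usesEdge b v w → w ≠ u → M.SeparatedAt P u v a b → M.SeparatedAt P v w a b := by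
    intro a b u v w ha ha' hb hb' hne h
    have hstep : ∀ {i j}, M.usesEdge i u v → M.usesEdge i v w → M.usesEdge j u v →
        M.usesEdge j v w → (M.Ahead v u i j ↔ M.Ahead w v i j) := fun hi hi' hj hj' =>
      (ahead_step (usesEdge_comm.1 hi') (usesEdge_comm.1 hi) (usesEdge_comm.1 hj')
        (usesEdge_comm.1 hj) hne.symm).symm
    rcases h with h | h | ⟨g, hg, h, h'⟩ | ⟨g, hg, h, h'⟩
    · exact .inl ((ahead_step ha ha' hb hb' hne).1 h)
    · exact .inr (.inl ((hstep hb hb' ha ha').1 h))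
    · have hg' := ((ahead_or_usesEdge ha ha' hb hb' hg.2 hne).1 h).resolve_right
        fun h'' => hcompat hb hg.2 h'' h'
      exact .inr (.inr (.inl ⟨g, ⟨hg.1, hg'⟩, (ahead_step ha ha' hg.2 hg' hne).1 h,
        (hstep hb hb' hg.2 hg').1 h'⟩))
    · have hg' := ((ahead_or_usesEdge hb hb' ha ha' hg.2 hne).2 h').resolve_right
        fun h'' => hcompat hg.2 ha h'' h
      exact .inr (.inr (.inr ⟨g, ⟨hg.1, hg'⟩, (hstep hg.2 hg' ha ha').1 h,
        (ahead_step hg.2 hg' hb hb' hne).1 h'⟩))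
  refine ⟨key ha ha' hb hb' hne, fun h => ?_⟩
  rw [separatedAt_swap] at h ⊢
  rw [usesEdge_comm] at ha ha' hb hb'
  exact key hb' hb ha' ha hne.symm h

theorem combAt_step (hU : ∀ i j : ι, i ≠ j → ¬ M.Unavoidable i j) {a b : ι} {u v w : V}
    (ha : M.usesEdge a u v) (ha' : M.usesEdge a v w) (hb : M.usesEdge b u v)
    (hb' : M.usesEdge b v w) (hne : w ≠ u) (h : M.CombAt P u v a b) : M.CombAt P v w a b := by
  refine h.imp (separatedAt_step hU ha ha' hb hb' hne).1 fun ⟨h1, h2, h3⟩ =>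
    ⟨?_, ?_, fun h => h3 ((separatedAt_step hU hb hb' ha ha' hne).2 h)⟩
  · have h : M.rest a u v <+: M.rest b u v := h1
    rw [rest_eq_cons ha ha' hne, rest_eq_cons hb hb' hne, List.prefix_cons_inj] at h
    exact h
  · have h : M.rest b v u <+: M.rest a v u := h2
    rw [usesEdge_comm] at ha ha' hb hb'
    change M.rest b w v <+: M.rest a w v
    rw [rest_eq_cons ha' ha hne.symm, rest_eq_cons hb' hb hne.symm, List.prefix_cons_inj]
    exact h

/-- Linear orders of the lines at all ports that are compatible along the lines and at their
separations. -/
structure PortOrder (M : MLCMInstance V ι) (Q : V → V → ι → ι → Prop) : Prop where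
  trans : ∀ {u v i j k}, M.usesEdge i u v → M.usesEdge j u v → M.usesEdge k u v →
    Q u v i j → Q u v j k → Q u v i k
  irrefl : ∀ {u v i}, M.usesEdge i u v → ¬ Q u v i i
  total : ∀ {u v i j}, M.usesEdge i u v → M.usesEdge j u v → i ≠ j → Q u v i j ∨ Q u v j i
  swap : ∀ {u v i j}, M.usesEdge i u v → M.usesEdge j u v → Q u v i j → Q v u j i
  step : ∀ {u v w i j}, M.usesEdge i u v → M.usesEdge i v w → M.usesEdge j u v →
    M.usesEdge j v w → w ≠ u → Q u v i j → Q v w i j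
  turn : ∀ {u v a b i j}, M.usesEdge i u v → M.usesEdge j u v → M.usesEdge i v a →
    M.usesEdge j v b → a ≠ u → b ≠ u → M.G.Clockwise v u a b → Q u v i j

theorem PortOrder.not_alternate {Q : V → V → ι → ι → Prop} (hQ : M.PortOrder Q)
    (hU : ∀ i j : ι, i ≠ j → ¬ M.Unavoidable i j) {lay : M.Layout}
    (hlay : ∀ {u v i j}, [i, j].Sublist (lay.ord u v) → Q u v i j) {i j : ι} (hij : i ≠ j)
    (u : V) : ¬ Alternate lay i j u := by
  have hasymm : ∀ {u v i j}, M.usesEdge i u v → M.usesEdge j u v → Q u v i j → ¬ Q u v j i :=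
    fun hi hj h h' => hQ.irrefl hi (hQ.trans hi hj hi h h')
  rintro ⟨a, b, c, d, ha, hb, hc, hd, h1, h2, h3⟩
  have h1' : M.G.pos u a < M.G.pos u b ∨ a = b ∧ Q u a i j := h1.imp id (And.imp id hlay)
  have h2' : M.G.pos u b < M.G.pos u c ∨ b = c ∧ Q u b j i := h2.imp id (And.imp id hlay)
  have h3' : M.G.pos u c < M.G.pos u d ∨ c = d ∧ Q u c i j := h3.imp id (And.imp id hlay)
  have ne : ∀ {x y}, M.G.pos u x < M.G.pos u y → x ≠ y := by
    rintro x _ h rfl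
    exact lt_irrefl _ h
  have sw : ∀ {i j x}, M.usesEdge i u x → M.usesEdge j u x → Q u x i j → ¬ Q x u i j :=
    fun hi hj h h' => hasymm (usesEdge_comm.1 hi) (usesEdge_comm.1 hj) h' (hQ.swap hi hj h)
  have tn : ∀ {x y z i j}, M.usesEdge i u x → M.usesEdge j u x → M.usesEdge i u y →
      M.usesEdge j u z → y ≠ x → z ≠ x → M.G.Clockwise u x y z → ¬ Q u x i j :=
    fun hi hj hi' hj' hy hz h h' =>
      sw hi hj h' (hQ.turn (usesEdge_comm.1 hi) (usesEdge_comm.1 hj) hi' hj' hy hz h)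
  clear h1 h2 h3
  rcases h1' with h1 | ⟨rfl, h1⟩ <;> rcases h2' with h2 | ⟨rfl, h2⟩ <;>
    rcases h3' with h3 | ⟨rfl, h3⟩
  · exact pos_not_alternate (hU i j hij) hij ha hb hc hd h1 h2 h3
  · refine tn hc hd ha hb (ne (h1.trans h2)) (ne h2) (.inr (.inl ⟨h1, h2⟩)) h3
  · exact tn hb hc hd ha (ne h3).symm (ne h1) (.inr (.inr ⟨h1, h3⟩)) h2
  · exact hasymm hb hc h2 h3
  · exact tn ha hb hc hd (ne h2).symm (ne (h2.trans h3)).symm (.inl ⟨h2, h3⟩) h1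
  · exact hasymm hc hd h3 (hQ.step (usesEdge_comm.1 hb) hd (usesEdge_comm.1 ha) hc (ne h2).symm
      (hQ.swap ha hb h1))
  · exact hasymm ha hb h1 h2
  · exact hasymm ha hb h1 h2

theorem PortOrder.exists_layout [Finite ι] {Q : V → V → ι → ι → Prop} (hQ : M.PortOrder Q)
    (hU : ∀ i j : ι, i ≠ j → ¬ M.Unavoidable i j) :
    ∃ lay : M.Layout, Feasible lay ∧ CrossingFree lay := by
  classical
  have := Fintype.ofFinite ι
  have hl : ∀ u v, ∃ l : List ι, l.Nodup ∧ (∀ i, i ∈ l ↔ M.usesEdge i u v) ∧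
      l.Pairwise (Q u v) := by
    intro u v
    obtain ⟨l, h1, h2, h3⟩ :=
      (Finset.univ.filter fun i => M.usesEdge i u v).exists_nodup_pairwise (Q u v)
        (by simpa using fun a ha b hb c hc => hQ.trans ha hb hc)
        (by simpa using fun a ha b hb => hQ.total ha hb)
        (by simpa using fun a ha => hQ.irrefl ha)
    exact ⟨l, h1, by simpa using h2, h3⟩
  choose ord h1 h2 h3 using hl
  let lay : M.Layout := ⟨ord, h1, h2⟩
  have hlay : ∀ {u v i j}, [i, j].Sublist (lay.ord u v) → Q u v i j :=
    fun h => List.pairwise_iff_forall_sublist.1 (h3 _ _) h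
  have hedge : ∀ i j u v, ¬ EdgeCross lay i j u v := by
    rintro i j u v ⟨hij, h, h'⟩
    have hi := (h2 u v i).1 (h.subset (by simp))
    have hj := (h2 u v j).1 (h.subset (by simp))
    have hi' := usesEdge_comm.1 hi
    exact hQ.irrefl hi' (hQ.trans hi' (usesEdge_comm.1 hj) hi' (hlay h') (hQ.swap hi hj (hlay h)))
  have hvertex : ∀ i j u, ¬ VertexCross lay i j u := by
    intro i j u h
    obtain ⟨hij, h | h⟩ := vertexCross_iff.1 (.inl h)
    · exact hQ.not_alternate hU hlay hij u h
    · exact hQ.not_alternate hU hlay hij.symm u h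
  refine ⟨lay, fun i j u h => absurd h (hvertex i j u), ?_⟩
  rintro i j - (⟨u, v, h | h⟩ | ⟨u, h | h⟩)
  · exact hedge _ _ _ _ h
  · exact hedge _ _ _ _ h
  · exact hvertex _ _ _ h
  · exact hvertex _ _ _ h

theorem InfixOf.trans {i j : ι} {p : List V} (hij : M.InfixOf i (M.line j)) (h : M.InfixOf j p) :
    M.InfixOf i p := by
  rcases h with h | h <;> rcases hij with hij | hij
  · exact .inl (h.trans hij)
  · exact .inr ((List.reverse_infix.2 h).trans hij)
  · exact .inr (h.trans hij)
  · refine .inl ?_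
    simpa using (List.reverse_infix.2 h).trans hij

theorem InfixOf.usesEdge {i j : ι} {u v : V} (h : M.InfixOf i (M.line j))
    (hj : M.usesEdge j u v) : M.usesEdge i u v := by
  rcases hj with hj | hj
  · exact (h.trans (.inl hj)).imp id id
  · exact ((h.trans (.inl hj)).imp id id).symm

/-- Every line can be mapped to a line that contains it in such a way that none of the values
contains another one. -/
theorem exists_representatives [Finite ι] (M : MLCMInstance V ι) : ∃ rep : ι → ι,
    (∀ i, M.InfixOf (rep i) (M.line i)) ∧
      ∀ i j, M.InfixOf (rep j) (M.line (rep i)) → rep i = rep j := by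
  classical
  have := Fintype.ofFinite ι
  let e := Fintype.equivFin ι
  let key : ι → ℕ ×ₗ Fin (Fintype.card ι) := fun i => toLex ((M.line i).length, e i)
  have hex : ∀ i, ∃ r, M.InfixOf r (M.line i) ∧
      ∀ j, M.InfixOf j (M.line i) → key j ≤ key r := by
    intro i
    obtain ⟨r, hr, hmax⟩ := (Finset.univ.filter fun r => M.InfixOf r (M.line i)).exists_max_image
      key ⟨i, by simpa using .inl List.infix_rfl⟩
    simp only [Finset.mem_filter, Finset.mem_univ, true_and] at hr hmax
    exact ⟨r, hr, hmax⟩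
  choose rep h1 h2 using hex
  refine ⟨rep, h1, fun i j hij => ?_⟩
  have hle := h2 i (rep j) (hij.trans (h1 i))
  have hlen : (M.line (rep i)).length ≤ (M.line (rep j)).length := by
    rcases hij with h | h
    · exact h.length_le
    · simpa using h.length_le
  have hlen' : (M.line (rep j)).length = (M.line (rep i)).length := by
    have := Prod.Lex.monotone_fst _ _ hle
    exact le_antisymm this hlen
  have hji : M.InfixOf (rep i) (M.line (rep j)) := by
    rcases hij with h | h
    · exact .inl (h.eq_of_length hlen'.symm ▸ List.infix_rfl)
    · refine .inr ?_
      rw [← h.eq_of_length (by simpa using hlen'.symm), List.reverse_reverse]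
  have hle' := h2 j (rep i) (hji.trans (h1 j))
  have := congrArg (fun x => (ofLex x).2) (le_antisymm hle' hle)
  exact e.injective this

/-- The lines at the port of `u` towards `v`: first by the order of the lines `rep i` that contain
them, then by the index `e i`, which is reversed if `rep i` runs from `v` to `u`. -/
def RepAt (M : MLCMInstance V ι) (rep : ι → ι) (e : ι → ℕ) (u v : V) (i j : ι) : Prop :=
  rep i ≠ rep j ∧ M.CombAt (· ∈ Set.range rep) u v (rep i) (rep j) ∨
    rep i = rep j ∧ ([u, v] <:+: M.line (rep i) ∧ e i < e j ∨
      [v, u] <:+: M.line (rep i) ∧ e j < e i)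

theorem portOrder_repAt (hU : ∀ i j : ι, i ≠ j → ¬ M.Unavoidable i j) {rep : ι → ι} {e : ι → ℕ}
    (he : e.Injective) (h1 : ∀ i, M.InfixOf (rep i) (M.line i))
    (h2 : ∀ i j, M.InfixOf (rep j) (M.line (rep i)) → rep i = rep j) :
    M.PortOrder (M.RepAt rep e) := by
  have hord := twoSidedOrder hU (P := (· ∈ Set.range rep)) (by
    rintro _ _ ⟨i, rfl⟩ ⟨j, rfl⟩
    exact h2 i j)
  have hrep : ∀ {i u v}, M.usesEdge i u v → rep i ∈ Set.range rep ∧ M.usesEdge (rep i) u v :=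
    fun {i u v} hi => ⟨⟨i, rfl⟩, (h1 i).usesEdge hi⟩
  refine ⟨?_, ?_, ?_, ?_, ?_, ?_⟩
  · intro u v i j k hi hj hk hij hjk
    have hl := (M.line_path (rep i)).1.not_pair_infix_swap (u := u) (v := v)
    rcases hij with ⟨hij, h⟩ | ⟨hij, h⟩ <;> rcases hjk with ⟨hjk, h'⟩ | ⟨hjk, h'⟩
    · have hik : rep i ≠ rep k := fun hik =>
        (hord u v).comb_asymm (hrep hi) (hrep hj) hij h (hik ▸ h')
      exact .inl ⟨hik, ((hord u v).comb_total (hrep hi) (hrep hk) hik).resolve_right fun h'' =>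
        (hord u v).no_cycle (hrep hi) (hrep hj) (hrep hk) hik.symm h h' h''⟩
    · exact .inl ⟨hjk ▸ hij, hjk ▸ h⟩
    · exact .inl ⟨hij ▸ hjk, hij ▸ h'⟩
    · rw [← hij] at h'
      refine .inr ⟨hij.trans hjk, ?_⟩
      rcases h with h | h <;> rcases h' with h' | h'
      · exact .inl ⟨h.1, h.2.trans h'.2⟩
      · exact absurd h'.1 (hl h.1)
      · exact absurd h.1 (hl h'.1)
      · exact .inr ⟨h.1, h'.2.trans h.2⟩
  · rintro u v i - (h | h)
    · exact h.1 rfl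
    · rcases h.2 with h | h <;> exact lt_irrefl _ h.2
  · intro u v i j hi hj hij
    by_cases hr : rep i = rep j
    · have := he.ne hij
      rcases this.lt_or_gt with h | h <;> rcases (hrep hi).2 with hl | hl
      · exact .inl (.inr ⟨hr, .inl ⟨hl, h⟩⟩)
      · exact .inr (.inr ⟨hr.symm, .inr ⟨hr ▸ hl, h⟩⟩)
      · exact .inr (.inr ⟨hr.symm, .inl ⟨hr ▸ hl, h⟩⟩)
      · exact .inl (.inr ⟨hr, .inr ⟨hl, h⟩⟩)
    · exact ((hord u v).comb_total (hrep hi) (hrep hj) hr).imp (fun h => .inl ⟨hr, h⟩)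
        fun h => .inl ⟨Ne.symm hr, h⟩
  · rintro u v i j - - (⟨hr, h⟩ | ⟨hr, h⟩)
    · exact .inl ⟨hr.symm, combAt_swap h⟩
    · exact .inr ⟨hr.symm, hr ▸ h.symm⟩
  · rintro u v w i j hi hi' hj hj' hne (⟨hr, h⟩ | ⟨hr, h⟩)
    · exact .inl ⟨hr, combAt_step hU (hrep hi).2 (hrep hi').2 (hrep hj).2 (hrep hj').2 hne h⟩
    · have hl := (M.line_path (rep i)).1
      refine .inr ⟨hr, h.imp (And.imp_left fun h => ?_) (And.imp_left fun h => ?_)⟩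
      · exact (hrep hi').2.resolve_right fun h' => hne (hl.pair_infix_right_unique h' h)
      · exact (hrep hi').2.resolve_left fun h' => hne <|
          (List.nodup_reverse.2 hl).pair_infix_right_unique (List.pair_infix_reverse.2 h')
            (List.pair_infix_reverse.2 h)
  · intro u v a b i j hi hj hi' hj' ha hb h
    refine .inl ⟨fun hr => ?_, .inl (.inl (ahead_of_clockwise (hrep hi).2 (hrep hj).2 (hrep hi').2
      (hrep hj').2 ha hb h))⟩
    have := rest_eq_cons (hrep hi).2 (hrep hi').2 ha
    rw [hr, rest_eq_cons (hrep hj).2 (hrep hj').2 hb, List.cons.injEq] at this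
    exact h.ne this.1.symm

end MLCMInstance

open MLCMInstance in
/-- Any instance of MLCM in which no pair of lines forms an
unavoidable crossing admits a crossing-free solution, i.e. a feasible line
layout in which no two lines cross. -/
theorem mlcm_no_unavoidable_crossing_implies_crossing_free_solution
    {V ι : Type} [Fintype ι] (M : MLCMInstance V ι)
    (h : ∀ i j : ι, i ≠ j → ¬ M.Unavoidable i j) :
    ∃ lay : M.Layout, Feasible lay ∧ CrossingFree lay := by
  obtain ⟨rep, h1, h2⟩ := exists_representatives M
  exact (portOrder_repAt h (Fin.val_injective.comp (Fintype.equivFin ι).injective) h1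
    h2).exists_layout h
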